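/- arXiv:1611.00789 — 3 statements merged into one kernel-verified Lean document; each statement's English description precedes it below -/
import Mathlib

section
/- Let K be a number field and let n be a positive integer. Then there exists a constant B = B(n, K) such that every finite subgroup G of the general linear group GL_n(K) satisfies |G| ≤ B; in other words, GL_n(K) has bounded finite subgroups. -/
/-- Second-order binomial expansion. -/
lemma mink_expand {R : Type*} [Ring R] (B : R) (k : ℕ) :
    ∃ Q : R, (1 + B) ^ k = 1 + (k : R) * B + B * B * Q := by
  induction k with
  | zero => exact ⟨0, by simp⟩
  | succ k ih =>
    obtain ⟨Q, hQ⟩ := ih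
    refine ⟨k + Q * (1 + B), ?_⟩
    rw [pow_succ, hQ]
    have h : (k : R) * B = B * k := (Nat.cast_commute k B).eq
    push_cast
    simp only [add_mul, mul_add, mul_one, one_mul, h, mul_assoc]
    abel

/-- An integer matrix divisible by all powers of three vanishes. -/
lemma mink_zero {m : ℕ} (B : Matrix (Fin m) (Fin m) ℤ)
    (h0 : ∃ C, B = (3 : ℤ) • C)
    (h : ∀ r : ℕ, 1 ≤ r → (∃ C, B = (3 ^ r : ℤ) • C) → ∃ C, B = (3 ^ (r + 1) : ℤ) • C) :
    B = 0 := by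
  have hall : ∀ r : ℕ, ∃ C, B = (3 ^ (r + 1) : ℤ) • C := by
    intro r
    induction r with
    | zero => simpa using h0
    | succ r ih => exact h (r + 1) (by omega) ih
  ext i j
  by_contra hne
  have hne' : B i j ≠ 0 := hne
  obtain ⟨C, hC⟩ := hall (B i j).natAbs
  have hd : (3 ^ ((B i j).natAbs + 1) : ℤ) ∣ B i j := ⟨C i j, by
    conv_lhs => rw [hC]
    simp⟩
  have hd' : 3 ^ ((B i j).natAbs + 1) ∣ (B i j).natAbs := by
    have := Int.natAbs_dvd_natAbs.mpr hd
    simpa [Int.natAbs_pow] using this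
  have h1 := Nat.le_of_dvd (Int.natAbs_pos.mpr hne') hd'
  have h2 : (B i j).natAbs + 1 < 3 ^ ((B i j).natAbs + 1) := Nat.lt_pow_self (by norm_num)
  omega

/-- Minkowski's lemma: torsion integer matrices congruent to one modulo three are trivial. -/
lemma mink_torsion {m : ℕ} (k : ℕ) : 0 < k → ∀ A : Matrix (Fin m) (Fin m) ℤ, A ^ k = 1 →
    (∃ C, A - 1 = (3 : ℤ) • C) → A = 1 := by
  induction k using Nat.strong_induction_on with
  | _ k ih =>
  intro hk A hA h3
  by_cases hd : 3 ∣ k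
  · obtain ⟨j, rfl⟩ := hd
    refine ih j (by omega) (by omega) A ?_ h3
    have hB : ∃ C, A ^ j - 1 = (3 : ℤ) • C := by
      obtain ⟨C, hC⟩ := h3
      refine ⟨C * ∑ i ∈ Finset.range j, A ^ i, ?_⟩
      rw [← mul_geom_sum, ← smul_mul_assoc, hC]
    have h1 : (A ^ j) ^ 3 = 1 := by rw [← pow_mul, mul_comm, hA]
    generalize A ^ j = D at hB h1 ⊢
    rw [← sub_eq_zero]
    refine mink_zero _ hB ?_
    rintro r hr ⟨C, hC⟩
    obtain ⟨s, rfl⟩ : ∃ s, r = s + 1 := ⟨r - 1, by omega⟩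
    have hD : D = 1 + (3 ^ (s + 1) : ℤ) • C := by rw [← hC]; abel
    refine ⟨-(3 ^ s : ℤ) • (C * C) - (3 ^ (2 * s) : ℤ) • (C * C * C), ?_⟩
    have key : (3 : ℤ) • (D - 1) = -((3 : ℤ) • ((D - 1) * (D - 1))) -
        (D - 1) * (D - 1) * (D - 1) := by
      have : D * D * D = 1 := by rw [← h1]; noncomm_ring
      have e : (D - 1) * (D - 1) * (D - 1) + (3 : ℤ) • ((D - 1) * (D - 1)) + (3 : ℤ) • (D - 1)
        = D * D * D - 1 := by noncomm_ring
      rw [this, sub_self] at e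
      rw [← sub_eq_zero, ← e]; abel
    rw [hC] at key ⊢
    ext a b
    have := congrFun (congrFun key a) b
    simp only [Matrix.smul_mul, Matrix.mul_smul, Matrix.smul_apply, Matrix.sub_apply,
      Matrix.neg_apply, smul_eq_mul] at this ⊢
    have h3 : (3 : ℤ) ≠ 0 := by norm_num
    apply mul_left_cancel₀ h3
    rw [this]
    ring
  · rw [← sub_eq_zero]
    refine mink_zero _ h3 ?_
    rintro r hr ⟨C, hC⟩
    obtain ⟨Q, hQ⟩ := mink_expand (A - 1) k
    rw [add_sub_cancel, hA] at hQ
    have hQ' : (k : ℤ) • (A - 1) = -((A - 1) * (A - 1) * Q) := by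
      have : (k : ℤ) • (A - 1) = (k : Matrix (Fin m) (Fin m) ℤ) * (A - 1) := by
        simp
      rw [this, ← sub_eq_zero]
      have := sub_eq_zero.mpr hQ.symm
      rw [← this]; abel
    have hdiv : ∀ a b, (3 ^ (r + 1) : ℤ) ∣ (A - 1) a b := by
      intro a b
      have h := congrFun (congrFun hQ' a) b
      have hc : IsCoprime ((3 : ℤ) ^ (r + 1)) (k : ℤ) := by
        apply IsCoprime.pow_left
        exact_mod_cast Nat.isCoprime_iff_coprime.mpr
          ((Nat.Prime.coprime_iff_not_dvd Nat.prime_three).mpr hd)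
      apply hc.dvd_of_dvd_mul_left
      have h' : (k : ℤ) * (A - 1) a b = (k • (A - 1)) a b := by simp
      obtain ⟨s, rfl⟩ : ∃ s, r = s + 1 := ⟨r - 1, by omega⟩
      refine ⟨-(3 ^ s * (C * C * Q) a b), ?_⟩
      have h2 : (k : ℤ) * (A - 1) a b = (-((A - 1) * (A - 1) * Q)) a b := by
        rw [← h]; simp
      rw [h2, hC]
      simp only [Matrix.smul_mul, Matrix.mul_smul, Matrix.smul_apply,
        Matrix.neg_apply, smul_eq_mul]
      ring
    choose c hc using hdiv
    exact ⟨Matrix.of c, by ext a b; rw [hc a b]; simp⟩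

/-- **Minkowski's theorem** (first half of Theorem 1.1): if `K` is a number field and
`n` a positive integer, then there is a constant `B = B(n, K)` bounding the order of
every finite subgroup `G` of `GL_n(K)`; i.e. `GL_n(K)` has bounded finite subgroups. -/
theorem minkowski_bounded_finite_subgroups_GL
    (K : Type*) [Field K] [NumberField K] (n : ℕ) (hn : 0 < n) :
    ∃ B : ℕ, ∀ G : Subgroup (GL (Fin n) K), Finite G → Nat.card G ≤ B := by
  refine ⟨3 ^ (Module.finrank ℚ (Fin n → K) * Module.finrank ℚ (Fin n → K)), ?_⟩
  intro G hG
  let v : G × Fin n → (Fin n → K) := fun p => (p.1 : GL (Fin n) K).1.mulVec (Pi.single p.2 1)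
  let L : Submodule ℤ (Fin n → K) := Submodule.span ℤ (Set.range v)
  let T : G → (Fin n → K) →ₗ[ℤ] (Fin n → K) := fun g =>
    (Matrix.mulVecLin (g : GL (Fin n) K).1).restrictScalars ℤ
  have hT : ∀ g, ∀ x ∈ L, T g x ∈ L := by
    intro g x hx
    have : L ≤ L.comap (T g) := by
      refine Submodule.span_le.mpr ?_
      rintro _ ⟨⟨h, i⟩, rfl⟩
      refine Submodule.subset_span ⟨(g * h, i), ?_⟩
      simp [v, T, -Matrix.mulVec_single, Matrix.mulVec_mulVec]
    exact this hx
  let f : G →* Module.End ℤ L :=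
    { toFun := fun g => (T g).restrict (hT g)
      map_one' := by
        ext x : 2
        simp [T]
      map_mul' := by
        intro g h
        ext x : 2
        simp [T] }
  have hf : ∀ g, f g = 1 → g = 1 := by
    intro g hg
    apply Subtype.ext
    apply Units.ext
    apply Matrix.ext_of_mulVec_single
    intro i
    have hx : (Pi.single i 1 : Fin n → K) ∈ L :=
      Submodule.subset_span ⟨(1, i), by simp [v, -Matrix.mulVec_single]⟩
    have := congrArg Subtype.val (LinearMap.congr_fun hg ⟨_, hx⟩)
    simpa [f, T, -Matrix.mulVec_single] using this
  have : Module.Finite ℤ L := Module.Finite.span_of_finite ℤ (Set.finite_range v)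
  have : IsAddTorsionFree (Fin n → K) := inferInstance
  have : Module.Free ℤ L := inferInstance
  let m := Module.finrank ℤ L
  let b : Module.Basis (Fin m) ℤ L := Module.finBasis ℤ L
  have hm : m ≤ Module.finrank ℚ (Fin n → K) := by
    have h1 : LinearIndependent ℤ (fun i => (b i : Fin n → K)) :=
      b.linearIndependent.map' L.subtype (by simp)
    have h2 := (LinearIndependent.iff_fractionRing ℤ ℚ).mp h1
    simpa using h2.fintype_card_le_finrank
  let F : G →* Matrix (Fin m) (Fin m) ℤ :=
    ((LinearMap.toMatrixAlgEquiv b : _ ≃ₐ[ℤ] _) : _ →* _).comp f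
  have hF : ∀ g, F g = 1 → g = 1 := by
    intro g hg
    apply hf
    apply (LinearMap.toMatrixAlgEquiv b).injective
    rw [map_one]; exact hg
  let φ : G →* Matrix (Fin m) (Fin m) (ZMod 3) :=
    ((Int.castRingHom (ZMod 3)).mapMatrix (m := Fin m)).toMonoidHom.comp F
  have hφ : Function.Injective φ := by
    rw [injective_iff_map_eq_one]
    intro g hg
    apply hF
    refine mink_torsion (Nat.card G) Nat.card_pos _ ?_ ?_
    · rw [← map_pow, pow_card_eq_one', map_one]
    · have : ∀ i j, (3 : ℤ) ∣ (F g - 1) i j := by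
        intro i j
        have h : ((Int.castRingHom (ZMod 3)).mapMatrix (F g - 1)) = 0 := by
          rw [map_sub, map_one, sub_eq_zero]; exact hg
        have h' := congrFun (congrFun h i) j
        exact (ZMod.intCast_zmod_eq_zero_iff_dvd _ 3).mp h'
      choose c hc using this
      exact ⟨Matrix.of c, by ext a b; rw [hc a b]; simp⟩
  calc Nat.card G ≤ Nat.card (Matrix (Fin m) (Fin m) (ZMod 3)) :=
        Nat.card_le_card_of_injective φ hφ
    _ = 3 ^ (m * m) := by
        simp [Matrix, Nat.card_eq_fintype_card, pow_mul]
    _ ≤ _ := Nat.pow_le_pow_right (by norm_num) (Nat.mul_le_mul hm hm)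
end

section
/- Let n be a positive integer, and let H be the subgroup of GL_3(ℤ/nℤ) consisting of all upper unitriangular matrices, i.e., matrices of the form [[1, a, c], [0, 1, b], [0, 0, 1]] with a, b, c ∈ ℤ/nℤ. Then every abelian subgroup A of H has index [H : A] ≥ n. -/
open Matrix

/-- The Heisenberg group over `ℤ/nℤ`: the subgroup of `GL₃(ℤ/nℤ)` consisting of all
upper unitriangular matrices `!![1, a, c; 0, 1, b; 0, 0, 1]` with `a, b, c ∈ ℤ/nℤ`. -/
def heisenberg (n : ℕ) : Subgroup (GL (Fin 3) (ZMod n)) where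
  carrier := {M | ∃ a b c : ZMod n,
    (M : Matrix (Fin 3) (Fin 3) (ZMod n)) = !![1, a, c; 0, 1, b; 0, 0, 1]}
  one_mem' := ⟨0, 0, 0, by simp [Matrix.one_fin_three]⟩
  mul_mem' := by
    rintro M N ⟨a, b, c, hM⟩ ⟨a', b', c', hN⟩
    refine ⟨a + a', b + b', c + a * b' + c', ?_⟩
    rw [Units.val_mul, hM, hN, Matrix.mul_fin_three]
    congr 1 <;> ring
  inv_mem' := by
    rintro M ⟨a, b, c, hM⟩
    refine ⟨-a, -b, a * b - c, ?_⟩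
    have h : (M : Matrix (Fin 3) (Fin 3) (ZMod n)) *
        !![1, -a, a * b - c; 0, 1, -b; 0, 0, 1] = 1 := by
      rw [hM, Matrix.mul_fin_three, Matrix.one_fin_three]
      congr 1 <;> ring
    calc ((M⁻¹ : GL (Fin 3) (ZMod n)) : Matrix (Fin 3) (Fin 3) (ZMod n))
        = ↑M⁻¹ * ((M : Matrix (Fin 3) (Fin 3) (ZMod n)) *
            !![1, -a, a * b - c; 0, 1, -b; 0, 0, 1]) := by rw [h, mul_one]
      _ = !![1, -a, a * b - c; 0, 1, -b; 0, 0, 1] := by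
          rw [← mul_assoc, ← Units.val_mul, inv_mul_cancel, Units.val_one, one_mul]

/-- Two additive subgroups of `ZMod n` that annihilate each other have
product of orders at most `n`. -/
lemma card_mul_card_le_of_annihilate (n : ℕ) (hn : 0 < n) (P K : AddSubgroup (ZMod n))
    (h : ∀ p ∈ P, ∀ k ∈ K, p * k = 0) : Nat.card P * Nat.card K ≤ n := by
  haveI : NeZero n := ⟨hn.ne'⟩
  obtain ⟨g, hg⟩ := (AddSubgroup.isAddCyclic_iff_exists_zmultiples_eq_top P).1 inferInstance
  have hgP : g ∈ P := hg ▸ AddSubgroup.mem_zmultiples g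
  let φ : ZMod n →+ ZMod n := AddMonoidHom.mulLeft g
  have hK : K ≤ φ.ker := fun k hk => h g hgP k hk
  have hP : P ≤ φ.range := by
    rw [← hg, AddSubgroup.zmultiples_le]
    exact ⟨1, mul_one g⟩
  have h1 := AddSubgroup.card_mul_index φ.ker
  rw [AddSubgroup.index_ker, Nat.card_zmod] at h1
  calc Nat.card P * Nat.card K ≤ Nat.card φ.range * Nat.card φ.ker :=
        Nat.mul_le_mul (AddSubgroup.card_le_of_le hP) (AddSubgroup.card_le_of_le hK)
    _ = n := by rw [mul_comm]; exact h1

lemma heis_mul (n : ℕ) (x y : heisenberg n) :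
    (x * y).1.1 0 1 = x.1.1 0 1 + y.1.1 0 1 ∧ (x * y).1.1 1 2 = x.1.1 1 2 + y.1.1 1 2 ∧
    (x * y).1.1 0 2 = x.1.1 0 2 + x.1.1 0 1 * y.1.1 1 2 + y.1.1 0 2 := by
  obtain ⟨M, a, b, c, hM⟩ := x
  obtain ⟨N, a', b', c', hN⟩ := y
  have : (((⟨M, a, b, c, hM⟩ : heisenberg n) * ⟨N, a', b', c', hN⟩ : heisenberg n)).1.1
      = M.1 * N.1 := rfl
  rw [this]
  simp only [hM, hN, Matrix.mul_fin_three]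
  refine ⟨?_, ?_, ?_⟩ <;> simp <;> ring

lemma heis_ext (n : ℕ) (x y : heisenberg n) (h1 : x.1.1 0 1 = y.1.1 0 1)
    (h2 : x.1.1 1 2 = y.1.1 1 2) (h3 : x.1.1 0 2 = y.1.1 0 2) : x = y := by
  obtain ⟨M, a, b, c, hM⟩ := x
  obtain ⟨N, a', b', c', hN⟩ := y
  apply Subtype.ext
  apply Units.ext
  simp only [hM, hN] at h1 h2 h3 ⊢
  simp at h1 h2 h3
  rw [h1, h2, h3]

/-- The matrix with given entries, as an element of the Heisenberg group. -/
def heisMk (n : ℕ) (a b c : ZMod n) : heisenberg n :=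
  ⟨⟨!![1, a, c; 0, 1, b; 0, 0, 1], !![1, -a, a * b - c; 0, 1, -b; 0, 0, 1],
    by rw [Matrix.mul_fin_three, Matrix.one_fin_three]; congr 1 <;> ring,
    by rw [Matrix.mul_fin_three, Matrix.one_fin_three]; congr 1 <;> ring⟩, a, b, c, rfl⟩

/-- The `a`-coordinate. -/
def heisA (n : ℕ) : Additive (heisenberg n) →+ ZMod n :=
  AddMonoidHom.mk' (fun x => x.toMul.1.1 0 1) fun x y => (heis_mul n x.toMul y.toMul).1

/-- The `b`-coordinate. -/
def heisB (n : ℕ) : Additive (heisenberg n) →+ ZMod n :=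
  AddMonoidHom.mk' (fun x => x.toMul.1.1 1 2) fun x y => (heis_mul n x.toMul y.toMul).2.1

theorem heisenberg_abelian_subgroup_index (n : ℕ) (hn : 0 < n)
    (A : Subgroup (heisenberg n)) (hA : ∀ x y : A, x * y = y * x) :
    n ≤ A.index := by
  haveI : NeZero n := ⟨hn.ne'⟩
  let B : AddSubgroup (Additive (heisenberg n)) := A.toAddSubgroup
  let f : B →+ ZMod n := (heisA n).comp B.subtype
  let g : f.ker →+ ZMod n := ((heisB n).comp B.subtype).comp f.ker.subtype
  have hPK : Nat.card f.range * Nat.card g.range ≤ n := by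
    apply card_mul_card_le_of_annihilate n hn
    rintro _ ⟨x, rfl⟩ _ ⟨⟨y, hy⟩, rfl⟩
    have hc : x.1.toMul * y.1.toMul = y.1.toMul * x.1.toMul :=
      congrArg Subtype.val (hA ⟨x.1.toMul, x.2⟩ ⟨y.1.toMul, y.2⟩)
    have e1 := (heis_mul n x.1.toMul y.1.toMul).2.2
    have e2 := (heis_mul n y.1.toMul x.1.toMul).2.2
    have hy' : y.1.toMul.1.1 0 1 = 0 := hy
    rw [hc, e2, hy'] at e1
    change x.1.toMul.1.1 0 1 * y.1.toMul.1.1 1 2 = 0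
    linear_combination -e1
  have hf : Nat.card f.ker * Nat.card f.range = Nat.card A := by
    have := AddSubgroup.card_mul_index f.ker
    rw [AddSubgroup.index_ker] at this
    exact this
  have hk : Nat.card f.ker ≤ Nat.card g.range * n := by
    have := Nat.card_le_card_of_injective
      (fun x : f.ker => ((⟨g x, x, rfl⟩, x.1.1.toMul.1.1 0 2) : g.range × ZMod n)) (by
        intro x y hxy
        simp only [Prod.mk.injEq] at hxy
        have hx : x.1.1.toMul.1.1 0 1 = 0 := x.2
        have hy : y.1.1.toMul.1.1 0 1 = 0 := y.2
        apply Subtype.ext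
        apply Subtype.ext
        exact heis_ext n x.1.1.toMul y.1.1.toMul (hx.trans hy.symm)
          (congrArg Subtype.val hxy.1) hxy.2)
    rwa [Nat.card_prod, Nat.card_zmod] at this
  have hH : n * n * n ≤ Nat.card (heisenberg n) := by
    have := Nat.card_le_card_of_injective
      (fun t : (ZMod n × ZMod n) × ZMod n => heisMk n t.1.1 t.1.2 t.2) (by
        rintro ⟨⟨a, b⟩, c⟩ ⟨⟨a', b'⟩, c'⟩ h
        have h1 := congrArg (fun x : heisenberg n => x.1.1 0 1) h
        have h2 := congrArg (fun x : heisenberg n => x.1.1 1 2) h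
        have h3 := congrArg (fun x : heisenberg n => x.1.1 0 2) h
        simp [heisMk] at h1 h2 h3
        simp [h1, h2, h3])
    simpa only [Nat.card_prod, Nat.card_zmod] using this
  have hAc : Nat.card A ≤ n * n := by
    rw [← hf]
    calc _ ≤ Nat.card g.range * n * Nat.card f.range := Nat.mul_le_mul_right _ hk
      _ = Nat.card f.range * Nat.card g.range * n := by ring
      _ ≤ n * n := Nat.mul_le_mul_right _ hPK
  rw [← A.card_mul_index] at hH
  have h2 : n * n * n ≤ n * n * A.index := hH.trans (Nat.mul_le_mul_right _ hAc)
  exact Nat.le_of_mul_le_mul_left h2 (Nat.mul_pos hn hn)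
end

section
/- Let K be a field of characteristic zero containing all roots of unity (i.e., for every positive integer m, K contains a primitive m-th root of unity). Let a, b ∈ K be nonzero, and suppose that the quaternion algebra Q = (a, b)_K over K is a division algebra, i.e., every nonzero element of Q is invertible. Then every finite subgroup of the quotient group Q*/Z(Q*) of the unit group of Q by its center has order at most 4. -/
open Quaternion

/-- A unit is central exactly when it commutes with everything; here: central units are scalars. -/
theorem QA_center_scalar {K : Type*} [Field K] [CharZero K] {a b : K} (ha : a ≠ 0)
    (hdiv : ∀ x : ℍ[K, a, b], x ≠ 0 → IsUnit x)
    (u : (ℍ[K, a, b])ˣ) (hu : u ∈ Subgroup.center (ℍ[K, a, b])ˣ) :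
    (u : ℍ[K, a, b]) = algebraMap K _ (u : ℍ[K, a, b]).re := by
  rw [Subgroup.mem_center_iff] at hu
  obtain ⟨i, hi⟩ := hdiv ⟨0, 1, 0, 0⟩ (by intro h; simpa using congrArg QuaternionAlgebra.imI h)
  obtain ⟨j, hj⟩ := hdiv ⟨0, 0, 1, 0⟩ (by intro h; simpa using congrArg QuaternionAlgebra.imJ h)
  have h1 := congrArg (fun x : (ℍ[K, a, b])ˣ => (x : ℍ[K, a, b])) (hu i)
  have h2 := congrArg (fun x : (ℍ[K, a, b])ˣ => (x : ℍ[K, a, b])) (hu j)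
  simp only [Units.val_mul, hi, hj] at h1 h2
  generalize (u : ℍ[K, a, b]) = x at *
  have e1 := congrArg QuaternionAlgebra.imK h1
  have e2 := congrArg QuaternionAlgebra.imJ h1
  have e3 := congrArg QuaternionAlgebra.imK h2
  simp at e1 e2 e3
  have f1 : x.imJ = 0 := by
    have : (2 : K) * x.imJ = 0 := by linear_combination e1
    simpa using this
  have f2 : x.imK = 0 := by
    have : (2 * a : K) * x.imK = 0 := by linear_combination e2
    simpa [ha] using this
  have f3 : x.imI = 0 := by
    have : (2 : K) * x.imI = 0 := by linear_combination -e3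
    simpa using this
  ext <;> simp [f1, f2, f3]

theorem QA_scalar_center {K : Type*} [Field K] {a b : K}
    (u : (ℍ[K, a, b])ˣ) (c : K) (h : (u : ℍ[K, a, b]) = algebraMap K _ c) :
    u ∈ Subgroup.center (ℍ[K, a, b])ˣ := by
  rw [Subgroup.mem_center_iff]
  intro g
  ext1
  simp only [Units.val_mul, h]
  exact (Algebra.commutes c _).symm

/-- An element of finite order modulo the scalars is pure or a scalar. -/
theorem QA_pure {K : Type*} [Field K] [CharZero K]
    (hroots : ∀ m : ℕ, 0 < m → ∃ ζ : K, IsPrimitiveRoot ζ m)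
    {a b : K}
    (hdiv : ∀ x : ℍ[K, a, b], x ≠ 0 → IsUnit x)
    (x : ℍ[K, a, b]) (hx : x ≠ 0) (n : ℕ) (hn : 0 < n) (c : K)
    (h : x ^ n = algebraMap K _ c) :
    x.re = 0 ∨ x = algebraMap K _ x.re := by
  classical
  have hnz : ∀ y z : ℍ[K, a, b], y * z = 0 → y = 0 ∨ z = 0 := by
    intro y z hyz
    by_cases hy : y = 0
    · exact Or.inl hy
    · right
      exact ((hdiv y hy).mul_right_eq_zero).1 hyz
  have : NoZeroDivisors ℍ[K, a, b] := ⟨fun {y z} => hnz y z⟩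
  have hs : star x ^ n = algebraMap K _ c := by
    rw [← star_pow, h]
    ext <;> simp
  obtain ⟨N, hN⟩ : ∃ N : K, x * star x = algebraMap K _ N := by
    obtain ⟨N, hN⟩ : ∃ N : K,
        N = x.re ^ 2 - a * x.imI ^ 2 - b * x.imJ ^ 2 + a * b * x.imK ^ 2 := ⟨_, rfl⟩
    refine ⟨N, ?_⟩
    ext <;> simp <;> (try rw [hN]) <;> ring
  have hsx : star x ≠ 0 := by simpa using hx
  have hN0 : N ≠ 0 := by
    rintro rfl
    rw [map_zero] at hN
    rcases hnz _ _ hN with h | h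
    · exact hx h
    · exact hsx h
  have hc0 : c ≠ 0 := by
    rintro rfl
    rw [map_zero] at h
    exact hx (pow_eq_zero_iff (by omega) |>.1 h)
  -- N ^ n = c ^ 2
  have hcomm : Commute x (star x) := by
    show x * star x = star x * x
    ext <;> simp <;> ring
  have hinj : Function.Injective (algebraMap K ℍ[K, a, b]) := (algebraMap K ℍ[K, a, b]).injective
  have hNc : N ^ n = c * c := by
    apply hinj
    rw [map_pow, ← hN, hcomm.mul_pow, h, hs, map_mul]
  obtain ⟨ζ, hζ⟩ := hroots n hn
  -- y = x ^ 2 / N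
  set y : ℍ[K, a, b] := N⁻¹ • (x ^ 2) with hy
  have hy1 : y ^ n = 1 := by
    rw [hy, smul_pow, ← pow_mul, mul_comm 2 n, pow_mul, h, ← map_pow, inv_pow, hNc, sq,
      Algebra.smul_def, ← map_mul, inv_mul_cancel₀ (mul_ne_zero hc0 hc0), map_one]
  obtain ⟨d, hd⟩ : ∃ d : K, y = algebraMap K _ d := by
    have hp := Polynomial.X_pow_sub_one_eq_prod hn hζ
    have hprod : ∀ s : Finset K,
        Polynomial.aeval y (∏ t ∈ s, (Polynomial.X - Polynomial.C t)) = 0 →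
        ∃ d : K, y = algebraMap K _ d := by
      intro s
      induction s using Finset.induction_on with
      | empty => intro h; simp at h
      | insert t s hts ih =>
        intro h
        rw [Finset.prod_insert hts, map_mul] at h
        rcases hnz _ _ h with h | h
        · refine ⟨t, ?_⟩
          simpa [sub_eq_zero] using h
        · exact ih h
    apply hprod (Polynomial.nthRootsFinset n (1 : K))
    rw [← hp]
    simp [hy1]
  have hx2 : x * x = algebraMap K _ (N * d) := by
    rw [map_mul, ← hd, hy, ← Algebra.smul_def, smul_smul, mul_inv_cancel₀ hN0, one_smul, sq]
  have e1 := congrArg QuaternionAlgebra.imI hx2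
  have e2 := congrArg QuaternionAlgebra.imJ hx2
  have e3 := congrArg QuaternionAlgebra.imK hx2
  simp at e1 e2 e3
  by_cases hr : x.re = 0
  · exact Or.inl hr
  right
  have f1 : x.imI = 0 := by
    have : (2 * x.re : K) * x.imI = 0 := by linear_combination e1
    simpa [hr] using this
  have f2 : x.imJ = 0 := by
    have : (2 * x.re : K) * x.imJ = 0 := by linear_combination e2
    simpa [hr] using this
  have f3 : x.imK = 0 := by
    have : (2 * x.re : K) * x.imK = 0 := by linear_combination e3
    simpa [hr] using this
  ext <;> simp [f1, f2, f3]

/-- Algebraic form of Theorem 1.4 (Bandman–Zarhin): let `K` be a field of characteristic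
zero containing all roots of unity, and let `Q = (a, b)_K` be a quaternion algebra over
`K` (with `a, b ≠ 0`) which is a division algebra, i.e. every nonzero element of `Q` is
invertible. Then every finite subgroup of `Qˣ/Z(Qˣ)` has order at most `4`. -/
theorem quaternion_division_algebra_finite_subgroups_of_units_mod_center
    (K : Type*) [Field K] [CharZero K]
    (hroots : ∀ m : ℕ, 0 < m → ∃ ζ : K, IsPrimitiveRoot ζ m)
    (a b : K) (ha : a ≠ 0) (hb : b ≠ 0)
    (hdiv : ∀ x : ℍ[K, a, b], x ≠ 0 → IsUnit x)
    (G : Subgroup ((ℍ[K, a, b])ˣ ⧸ Subgroup.center (ℍ[K, a, b])ˣ))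
    (hG : Finite G) :
    Nat.card G ≤ 4 := by
  classical
  have hpure : ∀ u : (ℍ[K, a, b])ˣ,
      (QuotientGroup.mk u : (ℍ[K, a, b])ˣ ⧸ Subgroup.center (ℍ[K, a, b])ˣ) ∈ G →
      (QuotientGroup.mk u : (ℍ[K, a, b])ˣ ⧸ Subgroup.center (ℍ[K, a, b])ˣ) ≠ 1 →
      (u : ℍ[K, a, b]).re = 0 := by
    intro u hu hu1
    have hpow : (QuotientGroup.mk (u ^ Nat.card G) :
        (ℍ[K, a, b])ˣ ⧸ Subgroup.center (ℍ[K, a, b])ˣ) = 1 := by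
      have := congrArg Subtype.val (pow_card_eq_one' (x := (⟨_, hu⟩ : G)))
      rw [QuotientGroup.mk_pow]
      exact this
    rw [QuotientGroup.eq_one_iff] at hpow
    have := QA_center_scalar ha hdiv _ hpow
    rw [Units.val_pow_eq_pow_val] at this
    rcases QA_pure hroots hdiv _ u.ne_zero _ Nat.card_pos _ this with h | h
    · exact h
    · exact absurd ((QuotientGroup.eq_one_iff u).2 (QA_scalar_center u _ h)) hu1
  have hstar : ∀ x : ℍ[K, a, b], x.re = 0 → star x = -x := by
    intro x hx
    ext <;> simp [hx]
  have hsq : ∀ q ∈ G, q * q = 1 := by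
    intro q
    induction q using QuotientGroup.induction_on with
    | H u =>
      intro hu
      by_cases h1 : (QuotientGroup.mk u : (ℍ[K, a, b])ˣ ⧸ Subgroup.center (ℍ[K, a, b])ˣ) = 1
      · rw [h1, one_mul]
      · have hr := hpure u hu h1
        rw [← QuotientGroup.mk_mul, QuotientGroup.eq_one_iff]
        refine QA_scalar_center _ ((u : ℍ[K, a, b]) * (u : ℍ[K, a, b])).re ?_
        rw [Units.val_mul]
        ext <;> simp [hr] <;> ring
  have hanti : ∀ u v : (ℍ[K, a, b])ˣ,
      (QuotientGroup.mk u : (ℍ[K, a, b])ˣ ⧸ Subgroup.center (ℍ[K, a, b])ˣ) ∈ G →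
      (QuotientGroup.mk v : (ℍ[K, a, b])ˣ ⧸ Subgroup.center (ℍ[K, a, b])ˣ) ∈ G →
      (QuotientGroup.mk u : (ℍ[K, a, b])ˣ ⧸ Subgroup.center (ℍ[K, a, b])ˣ) ≠ 1 →
      (QuotientGroup.mk v : (ℍ[K, a, b])ˣ ⧸ Subgroup.center (ℍ[K, a, b])ˣ) ≠ 1 →
      (QuotientGroup.mk u : (ℍ[K, a, b])ˣ ⧸ Subgroup.center (ℍ[K, a, b])ˣ) ≠ QuotientGroup.mk v →
      (u : ℍ[K, a, b]) * v = - (v * u) := by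
    intro u v hu hv hu1 hv1 huv
    have h := hstar _ (hpure (u * v) (by rw [QuotientGroup.mk_mul]; exact G.mul_mem hu hv) (by
      rw [QuotientGroup.mk_mul]
      intro h
      exact huv (mul_right_cancel (h.trans (hsq _ hv).symm))))
    rw [Units.val_mul, star_mul, hstar _ (hpure u hu hu1), hstar _ (hpure v hv hv1), neg_mul_neg] at h
    rw [h, neg_neg]
  have key : ∀ p q r, p ∈ G → q ∈ G → r ∈ G → p ≠ 1 → q ≠ 1 → p ≠ q → r ≠ 1 → r ≠ p → r ≠ q →
      r = p * q := by
    intro p q r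
    induction p using QuotientGroup.induction_on with
    | H u =>
    induction q using QuotientGroup.induction_on with
    | H v =>
    induction r using QuotientGroup.induction_on with
    | H w =>
    intro hu hv hw hu1 hv1 huv hw1 hwu hwv
    by_contra hne
    have e1 := hanti w u hw hu hw1 hu1 hwu
    have e2 := hanti w v hw hv hw1 hv1 hwv
    have e3 := hanti w (u * v) hw (by rw [QuotientGroup.mk_mul]; exact G.mul_mem hu hv) hw1 (by
      rw [QuotientGroup.mk_mul]
      intro h
      exact huv (mul_right_cancel (h.trans (hsq _ hv).symm))) (by
      rw [QuotientGroup.mk_mul]; exact hne)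
    rw [Units.val_mul, ← mul_assoc, e1, neg_mul, mul_assoc, e2, mul_neg, neg_neg, ← mul_assoc] at e3
    have e4 : ((u * v * w : (ℍ[K, a, b])ˣ) : ℍ[K, a, b]) = -((u * v * w : (ℍ[K, a, b])ˣ)) := by
      simpa only [Units.val_mul] using e3
    have e5 : (2 : K) • ((u * v * w : (ℍ[K, a, b])ˣ) : ℍ[K, a, b]) = 0 := by
      rw [two_smul]
      exact add_eq_zero_iff_eq_neg.2 e4
    rcases smul_eq_zero.1 e5 with h | h
    · exact two_ne_zero h
    · exact (u * v * w).ne_zero h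
  have hsub : ∃ p q, (G : Set ((ℍ[K, a, b])ˣ ⧸ Subgroup.center (ℍ[K, a, b])ˣ)) ⊆ {1, p, q, p * q} := by
    by_cases h1 : ∃ p ∈ G, p ≠ 1
    · obtain ⟨p, hp, hp1⟩ := h1
      by_cases h2 : ∃ q ∈ G, q ≠ 1 ∧ p ≠ q
      · obtain ⟨q, hq, hq1, hpq⟩ := h2
        refine ⟨p, q, fun r hr => ?_⟩
        simp only [Set.mem_insert_iff, Set.mem_singleton_iff]
        have := key p q r hp hq hr hp1 hq1 hpq
        tauto
      · push Not at h2
        refine ⟨p, 1, fun r hr => ?_⟩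
        simp only [Set.mem_insert_iff, Set.mem_singleton_iff]
        have := h2 r hr
        by_cases hr1 : r = 1
        · exact Or.inl hr1
        · exact Or.inr (Or.inl (this hr1).symm)
    · push Not at h1
      exact ⟨1, 1, fun r hr => by simp [h1 r hr]⟩
  obtain ⟨p, q, h⟩ := hsub
  have h1 : Nat.card G ≤ ({1, p, q, p * q} : Set _).ncard := Set.ncard_le_ncard h (by simp)
  refine h1.trans ?_
  have := Set.ncard_insert_le 1 {p, q, p * q}
  have := Set.ncard_insert_le p {q, p * q}
  have := Set.ncard_insert_le q {p * q}
  have := Set.ncard_singleton (p * q)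
  omega
end
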